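/- When real quadratic fields are ordered by discriminant, a density of 100% of them satisfy Cl₂(F) ≠ Cl₂⁺(F); that is, lim_{X→∞} #{real quadratic F : Disc(F)<X, |Cl₂⁺(F)| = |Cl₂(F)|} / #{real quadratic F : Disc(F)<X} = 0. -/

import Mathlib

open NumberField Filter Topology
open scoped nonZeroDivisors Classical

noncomputable section

/-- The setoid of subfields of `ℂ` (finite over `ℚ` or not), up to `ℚ`-algebra isomorphism. -/
def isoSetoid : Setoid (IntermediateField ℚ ℂ) where
  r K L := Nonempty (↥K ≃ₐ[ℚ] ↥L)
  iseqv := ⟨fun _ => ⟨AlgEquiv.refl⟩, fun ⟨e⟩ => ⟨e.symm⟩, fun ⟨e⟩ ⟨f⟩ => ⟨e.trans f⟩⟩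

/-- Isomorphism classes of subfields of `ℂ`; since every number field embeds into `ℂ`,
every isomorphism class of number fields is represented here. -/
abbrev FieldClass : Type := Quotient isoSetoid

/-- `K` is a cubic field. -/
def IsCubic (K : IntermediateField ℚ ℂ) : Prop := Module.finrank ℚ ↥K = 3

/-- `K` (cubic) is totally real: it has three real embeddings. -/
def IsTotallyRealCubic (K : IntermediateField ℚ ℂ) : Prop :=
  Module.finrank ℚ ↥K = 3 ∧ Nat.card (↥K →+* ℝ) = 3

/-- `K` is a complex cubic field: cubic with exactly one real embedding. -/
def IsComplexCubic (K : IntermediateField ℚ ℂ) : Prop :=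
  Module.finrank ℚ ↥K = 3 ∧ Nat.card (↥K →+* ℝ) = 1

/-- `K` is a real quadratic field. -/
def IsRealQuadratic (K : IntermediateField ℚ ℂ) : Prop :=
  Module.finrank ℚ ↥K = 2 ∧ Nat.card (↥K →+* ℝ) = 2

/-- The discriminant of a subfield of `ℂ` that is a number field (junk value `0` otherwise). -/
def intDisc (K : IntermediateField ℚ ℂ) : ℤ :=
  letI : CharZero ↥K := charZero_of_injective_algebraMap (algebraMap ℚ ↥K).injective
  if h : FiniteDimensional ℚ ↥K then
    letI := h
    letI : NumberField ↥K := ⟨⟩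
    NumberField.discr ↥K
  else 0

/-- The absolute value of the discriminant. -/
def absDisc (K : IntermediateField ℚ ℂ) : ℕ := (intDisc K).natAbs

/-- The class number `|Cl(K)|`. -/
def clCard (K : IntermediateField ℚ ℂ) : ℕ := Nat.card (ClassGroup (𝓞 ↥K))

/-- The number of 2-torsion elements of the class group. -/
def cl2Card (K : IntermediateField ℚ ℂ) : ℕ :=
  Nat.card {c : ClassGroup (𝓞 ↥K) // c ^ 2 = 1}

/-- The narrow class group of a number field `K`: the quotient of the group of invertible
fractional ideals of `𝓞 K` by the subgroup generated by principal fractional ideals with a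
totally positive generator. -/
abbrev narrowClassGroup (K : Type*) [Field K] [NumberField K] : Type _ :=
  (FractionalIdeal (𝓞 K)⁰ K)ˣ ⧸
    Subgroup.closure {I : (FractionalIdeal (𝓞 K)⁰ K)ˣ |
      ∃ x : Kˣ, (∀ σ : K →+* ℝ, 0 < σ (x : K)) ∧ toPrincipalIdeal (𝓞 K) K x = I}

/-- The cardinality of the narrow class group (junk value `0` if not a number field). -/
def clPlusCard (K : IntermediateField ℚ ℂ) : ℕ :=
  letI : CharZero ↥K := charZero_of_injective_algebraMap (algebraMap ℚ ↥K).injective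
  if h : FiniteDimensional ℚ ↥K then
    letI := h
    letI : NumberField ↥K := ⟨⟩
    Nat.card (narrowClassGroup ↥K)
  else 0

/-- The number of 2-torsion elements of the narrow class group. -/
def cl2PlusCard (K : IntermediateField ℚ ℂ) : ℕ :=
  letI : CharZero ↥K := charZero_of_injective_algebraMap (algebraMap ℚ ↥K).injective
  if h : FiniteDimensional ℚ ↥K then
    letI := h
    letI : NumberField ↥K := ⟨⟩
    Nat.card {c : narrowClassGroup ↥K // c ^ 2 = 1}
  else 0

/-- The number of isomorphism classes of number fields (as subfields of `ℂ`) satisfying an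
isomorphism-invariant predicate `P`. -/
def classCount (P : IntermediateField ℚ ℂ → Prop) : ℕ :=
  Nat.card {c : FieldClass // P c.out}

end

open ArithmeticFunction.vonMangoldt in
/-- The sum of the reciprocals of the primes in an invertible residue class diverges. -/
theorem not_summable_one_div_primes_residueClass {q : ℕ} [NeZero q] {a : ZMod q} (ha : IsUnit a) :
    ¬ Summable (fun n : ℕ ↦ if n.Prime ∧ (n : ZMod q) = a then (1 : ℝ) / n else 0) := by
  intro hg
  set g : ℕ → ℝ := fun n ↦ if n.Prime ∧ (n : ZMod q) = a then (1 : ℝ) / n else 0 with hgdef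
  have hg0 (n) : 0 ≤ g n := by simp only [hgdef]; positivity
  set f : ℕ → ℝ := fun n ↦ (if n.Prime then 0 else residueClass a n) / n with hfdef
  have hf : Summable f := summable_residueClass_non_primes_div a
  obtain ⟨C, hC⟩ := LSeries_residueClass_lower_bound ha
  have hrpow (n : ℕ) {δ : ℝ} (hδ : 0 < δ) : 0 ≤ (n : ℝ) ^ (-δ) ∧ (n : ℝ) ^ (-δ) ≤ 1 := by
    refine ⟨by positivity, ?_⟩
    rcases n.eq_zero_or_pos with rfl | hn
    · simp [Real.zero_rpow (neg_ne_zero.2 hδ.ne')]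
    · exact Real.rpow_le_one_of_one_le_of_nonpos (mod_cast hn) (by linarith)
  have hbound {δ : ℝ} (hδ : 0 < δ) (n : ℕ) : ‖g n * (1 - (n : ℝ) ^ (-δ))‖ ≤ g n := by
    have := hrpow n hδ
    rw [norm_mul, Real.norm_of_nonneg (hg0 n), Real.norm_of_nonneg (by linarith)]
    exact mul_le_of_le_one_right (hg0 n) (by linarith)
  have hterm {δ : ℝ} (hδ : 0 < δ) (n : ℕ) :
      δ * (residueClass a n / (n : ℝ) ^ (1 + δ)) ≤ δ * f n + g n * (1 - (n : ℝ) ^ (-δ)) := by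
    rcases n.eq_zero_or_pos with rfl | hn
    · simp [hfdef, hgdef]
    have hn' : (0 : ℝ) < n := mod_cast hn
    have hr := residueClass_nonneg a n
    have hp := hrpow n hδ
    have e1 : residueClass a n / (n : ℝ) ^ (1 + δ) = residueClass a n / n * (n : ℝ) ^ (-δ) := by
      rw [Real.rpow_add hn', Real.rpow_one, Real.rpow_neg hn'.le]
      field_simp
    rw [e1]
    by_cases hpr : n.Prime
    · by_cases hna : (n : ZMod q) = a
      · have e2 : residueClass a n = Real.log n := by
          simp [residueClass, hna, ArithmeticFunction.vonMangoldt_apply_prime hpr]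
        have e3 : δ * Real.log n * (n : ℝ) ^ (-δ) ≤ 1 - (n : ℝ) ^ (-δ) := by
          have h1 := Real.add_one_le_exp (δ * Real.log n)
          have h2 : Real.exp (δ * Real.log n) * (n : ℝ) ^ (-δ) = 1 := by
            rw [Real.rpow_def_of_pos hn', ← Real.exp_add]
            simp [mul_comm]
          nlinarith
        simp only [hfdef, hgdef, hpr, hna, e2, and_self, if_true, zero_div, mul_zero, zero_add]
        calc _ = 1 / (n : ℝ) * (δ * Real.log n * (n : ℝ) ^ (-δ)) := by ring
          _ ≤ _ := by gcongr
      · simp [hfdef, hgdef, hna, hpr, residueClass]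
    · simp only [hfdef, hgdef, hpr, if_false, false_and, zero_mul, add_zero]
      gcongr
      exact mul_le_of_le_one_right (by positivity) hp.2
  have hkey : ∀ᶠ δ : ℝ in 𝓝[>] 0, (q.totient : ℝ)⁻¹ - C * δ ≤
      δ * ∑' n, f n + ∑' n, g n * (1 - (n : ℝ) ^ (-δ)) := by
    filter_upwards [Ioc_mem_nhdsGT (show (0 : ℝ) < 1 by norm_num)] with δ hδ
    have h1 := hC (x := 1 + δ) ⟨by linarith [hδ.1], by linarith [hδ.2]⟩
    have hs : Summable fun n ↦ residueClass a n / (n : ℝ) ^ (1 + δ) :=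
      LSeries.summable_real_of_abscissaOfAbsConv_lt <|
        (abscissaOfAbsConv_residueClass_le_one a).trans_lt <| mod_cast (by linarith [hδ.1])
    have hs2 : Summable fun n ↦ g n * (1 - (n : ℝ) ^ (-δ)) :=
      Summable.of_norm_bounded hg (hbound hδ.1)
    have h2 := Summable.tsum_le_tsum (hterm hδ.1) (hs.mul_left δ) ((hf.mul_left δ).add hs2)
    rw [(hf.mul_left δ).tsum_add hs2, tsum_mul_left, tsum_mul_left] at h2
    refine le_trans (le_of_eq ?_) ((mul_le_mul_of_nonneg_left h1 hδ.1.le).trans h2)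
    have := hδ.1.ne'
    rw [add_sub_cancel_left]
    field_simp
  have hlim : Tendsto (fun δ : ℝ ↦ ∑' n, g n * (1 - (n : ℝ) ^ (-δ))) (𝓝[>] 0)
      (𝓝 (∑' n : ℕ, (0 : ℝ))) := by
    refine tendsto_tsum_of_dominated_convergence hg (fun n ↦ ?_) ?_
    · rcases n.eq_zero_or_pos with rfl | hn
      · simp [hgdef]
      have : ContinuousAt (fun δ : ℝ ↦ g n * (1 - (n : ℝ) ^ (-δ))) 0 := by
        have : (n : ℝ) ≠ 0 := by positivity
        fun_prop (disch := simp_all)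
      simpa using this.tendsto.mono_left nhdsWithin_le_nhds
    · filter_upwards [self_mem_nhdsWithin] with δ hδ n using hbound hδ n
  have hid : Tendsto (fun δ : ℝ ↦ δ) (𝓝[>] 0) (𝓝 0) := nhdsWithin_le_nhds
  have := le_of_tendsto_of_tendsto ((hid.const_mul C).const_sub (q.totient : ℝ)⁻¹)
    ((hid.mul_const (∑' n, f n)).add hlim) hkey
  simp only [mul_zero, sub_zero, zero_mul, tsum_zero, add_zero] at this
  have hq : 0 < (q.totient : ℝ)⁻¹ := inv_pos.mpr (mod_cast q.totient.pos_of_neZero)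
  linarith

/-- Products of primes in an invertible residue class have arbitrarily small totient ratio. -/
theorem exists_totient_lt_mul_of_primes_residueClass {q : ℕ} [NeZero q] {a : ZMod q}
    (ha : IsUnit a) {ε : ℝ} (hε : 0 < ε) :
    ∃ M : ℕ, 0 < M ∧ (∀ p : ℕ, p ∈ M.primeFactors → (p : ZMod q) = a) ∧
      (M.totient : ℝ) < ε * M := by
  have hns := not_summable_one_div_primes_residueClass ha
  obtain ⟨N, hN⟩ := ((not_summable_iff_tendsto_nat_atTop_of_nonneg
    (fun n ↦ by positivity)).1 hns).eventually_gt_atTop (-Real.log ε) |>.exists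
  set s := (Finset.range N).filter fun p : ℕ ↦ p.Prime ∧ (p : ZMod q) = a with hs
  rw [← Finset.sum_filter] at hN
  have hprime : ∀ p ∈ s, p.Prime := fun p hp ↦ (Finset.mem_filter.1 hp).2.1
  have hfac := Nat.primeFactors_prod hprime
  have hpos : 0 < ∏ p ∈ s, p := Finset.prod_pos fun p hp ↦ (hprime p hp).pos
  refine ⟨∏ p ∈ s, p, hpos, fun p hp ↦ ?_, ?_⟩
  · rw [hfac] at hp
    exact (Finset.mem_filter.1 hp).2.2
  · have h := congrArg (fun x : ℚ ↦ (x : ℝ)) (Nat.totient_eq_mul_prod_factors (∏ p ∈ s, p))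
    simp only [Rat.cast_natCast, Rat.cast_mul] at h
    rw [h, hfac, mul_comm ε]
    have hpos' : (0 : ℝ) < ((∏ p ∈ s, p : ℕ) : ℝ) := mod_cast hpos
    refine mul_lt_mul_of_pos_left ?_ hpos'
    push_cast
    calc ∏ p ∈ s, (1 - (p : ℝ)⁻¹) ≤ ∏ p ∈ s, Real.exp (-(1 / p : ℝ)) := by
          refine Finset.prod_le_prod (fun p hp ↦ ?_) fun p hp ↦ ?_
          · have : (1 : ℝ) ≤ p := mod_cast (hprime p hp).one_lt.le
            simpa using inv_le_one_of_one_le₀ this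
          · have := Real.add_one_le_exp (-(1 / p : ℝ))
            rw [one_div] at *
            linarith
      _ = Real.exp (-∑ p ∈ s, (1 / p : ℝ)) := by
          rw [← Real.exp_sum, Finset.sum_neg_distrib]
      _ < ε := by
          rw [← Real.lt_log_iff_exp_lt hε]
          linarith

/-- Integers without prime factors in an invertible residue class have density zero. -/
theorem card_filter_coprime_residueClass_le {q : ℕ} [NeZero q] {a : ZMod q}
    (ha : IsUnit a) {ε : ℝ} (hε : 0 < ε) :
    ∃ C : ℝ, ∀ N : ℕ,
      (((Finset.range N).filter fun n ↦ ∀ p : ℕ, p ∈ n.primeFactors → (p : ZMod q) ≠ a).card : ℝ) ≤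
        ε * N + C := by
  obtain ⟨M, hM, hMa, hlt⟩ := exists_totient_lt_mul_of_primes_residueClass ha hε
  refine ⟨M.totient + 1, fun N ↦ ?_⟩
  have hsub : ((Finset.range N).filter fun n ↦ ∀ p : ℕ, p ∈ n.primeFactors → (p : ZMod q) ≠ a) ⊆
      insert 0 ((Finset.Ico 0 (0 + N)).filter fun n ↦ M.Coprime n) := by
    intro n hn
    simp only [Finset.mem_filter, Finset.mem_range, Finset.mem_insert, Finset.mem_Ico] at hn ⊢
    rcases n.eq_zero_or_pos with h0 | h0
    · exact Or.inl h0
    · refine Or.inr ⟨by omega, Nat.Coprime.symm <| Nat.coprime_of_dvd fun p hp hpn hpM ↦ ?_⟩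
      exact hn.2 p (Nat.mem_primeFactors.2 ⟨hp, hpn, h0.ne'⟩)
        (hMa p (Nat.mem_primeFactors.2 ⟨hp, hpM, hM.ne'⟩))
  have h1 := (Finset.card_le_card hsub).trans (Finset.card_insert_le _ _)
  have h2 : (((Finset.range N).filter
      fun n ↦ ∀ p : ℕ, p ∈ n.primeFactors → (p : ZMod q) ≠ a).card : ℝ) ≤
      ((M.totient * (N / M + 1) + 1 : ℕ) : ℝ) :=
    mod_cast h1.trans (Nat.add_le_add_right (Nat.Ico_filter_coprime_le 0 N hM.ne') 1)
  refine h2.trans ?_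
  push_cast
  have h3 : ((N / M : ℕ) : ℝ) ≤ N / M := Nat.cast_div_le
  have h4 : (M.totient : ℝ) * ((N / M : ℕ) : ℝ) ≤ ε * N := by
    calc _ ≤ (M.totient : ℝ) * (N / M) := by gcongr
      _ ≤ (ε * M) * (N / M) := by gcongr
      _ = ε * N := by field_simp
  linarith

theorem sum_Ioc_one_div_sq_le (m : ℕ) :
    ∑ k ∈ Finset.Ioc 1 (m + 1), (1 : ℝ) / k ^ 2 ≤ 2 / 3 - 2 / (2 * m + 3) := by
  induction m with
  | zero => norm_num
  | succ m ih =>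
    rw [Finset.sum_Ioc_succ_top (by omega)]
    have : (1 : ℝ) / ((m + 1 + 1 : ℕ) : ℝ) ^ 2 ≤ 2 / (2 * m + 3) - 2 / (2 * (m + 1) + 3) := by
      push_cast
      rw [div_sub_div _ _ (by positivity) (by positivity), div_le_div_iff₀ (by positivity)
        (by positivity)]
      nlinarith
    push_cast at *
    linarith

/-- At least a third of the positive integers up to `N` are squarefree. -/
theorem le_three_mul_card_squarefree (N : ℕ) :
    N ≤ 3 * ((Finset.Ioc 0 N).filter Squarefree).card := by
  rcases N with _ | m
  · simp
  set N := m + 1 with hN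
  have hsub : (Finset.Ioc 0 N).filter (fun n ↦ ¬ Squarefree n) ⊆
      (Finset.Ioc 1 N).biUnion fun k ↦ (Finset.Ioc 0 N).filter fun n ↦ k ^ 2 ∣ n := by
    intro n hn
    simp only [Finset.mem_filter, Finset.mem_Ioc, Finset.mem_biUnion] at hn ⊢
    obtain ⟨⟨h0, hN⟩, hsq⟩ := hn
    rw [Nat.squarefree_iff_prime_squarefree] at hsq
    push Not at hsq
    obtain ⟨p, hp, hpn⟩ := hsq
    refine ⟨p, ⟨hp.one_lt, ?_⟩, ⟨h0, hN⟩, by rwa [sq]⟩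
    exact (Nat.le_of_dvd h0 ((dvd_mul_right p p).trans hpn)).trans hN
  have h1 : (((Finset.Ioc 0 N).filter (fun n ↦ ¬ Squarefree n)).card : ℝ) ≤
      N * ∑ k ∈ Finset.Ioc 1 N, (1 : ℝ) / k ^ 2 := by
    refine (Nat.cast_le.2 ((Finset.card_le_card hsub).trans Finset.card_biUnion_le)).trans ?_
    rw [Nat.cast_sum, Finset.mul_sum]
    refine Finset.sum_le_sum fun k _ ↦ ?_
    rw [Nat.Ioc_filter_dvd_card_eq_div, mul_one_div]
    exact_mod_cast Nat.cast_div_le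
  have h2 := sum_Ioc_one_div_sq_le m
  have h3 : (N : ℝ) * ∑ k ∈ Finset.Ioc 1 N, (1 : ℝ) / k ^ 2 ≤ N * (2 / 3) := by
    gcongr
    have : (0 : ℝ) ≤ 2 / (2 * m + 3) := by positivity
    linarith
  have h4 := Finset.card_filter_add_card_filter_not (s := Finset.Ioc 0 N) Squarefree
  rw [Nat.card_Ioc, tsub_zero] at h4
  have h5 : (((Finset.Ioc 0 N).filter Squarefree).card : ℝ) +
    ((Finset.Ioc 0 N).filter (fun n ↦ ¬ Squarefree n)).card = N := mod_cast h4
  rify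
  linarith

/-- In a finite commutative group, the number of 2-torsion elements is the index of the
subgroup of squares. -/
theorem card_two_torsion_eq_index (A : Type*) [CommGroup A] [Finite A] :
    Nat.card {c : A // c ^ 2 = 1} = (powMonoidHom 2 : A →* A).range.index := by
  have h1 := (powMonoidHom 2 : A →* A).ker.card_mul_index
  have h2 := (powMonoidHom 2 : A →* A).range.card_mul_index
  rw [Subgroup.index_ker, ← h2, mul_comm] at h1
  exact Nat.eq_of_mul_eq_mul_left Nat.card_pos h1

/-- A surjective homomorphism of finite commutative groups that kills a nonsquare strictly
decreases the number of 2-torsion elements. -/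
theorem card_two_torsion_lt_of_surjective {G H : Type*} [Group G] [Group H] [Finite G]
    (hcomm : ∀ a b : G, a * b = b * a) (f : G →* H) (hf : Function.Surjective f) (k : G)
    (hk : f k = 1) (hsq : ∀ c : G, c ^ 2 ≠ k) :
    Nat.card {c : H // c ^ 2 = 1} < Nat.card {c : G // c ^ 2 = 1} := by
  let : CommGroup G := { ‹Group G› with mul_comm := hcomm }
  let : CommGroup H :=
    { ‹Group H› with
      mul_comm := fun x y ↦ by
        obtain ⟨a, rfl⟩ := hf x
        obtain ⟨b, rfl⟩ := hf y
        rw [← map_mul, hcomm, map_mul] }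
  have : Finite H := Finite.of_surjective f hf
  rw [card_two_torsion_eq_index, card_two_torsion_eq_index]
  have hmap : (powMonoidHom 2 : H →* H).range = (powMonoidHom 2 : G →* G).range.map f := by
    ext y
    simp only [MonoidHom.mem_range, Subgroup.mem_map, powMonoidHom_apply]
    constructor
    · rintro ⟨z, rfl⟩
      obtain ⟨x, rfl⟩ := hf z
      exact ⟨x ^ 2, ⟨x, rfl⟩, map_pow f x 2⟩
    · rintro ⟨_, ⟨x, rfl⟩, rfl⟩
      exact ⟨f x, (map_pow f x 2).symm⟩
  rw [hmap, Subgroup.index_map, MonoidHom.range_eq_top.2 hf, Subgroup.index_top, mul_one]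
  refine Subgroup.index_strictAnti (lt_of_le_of_ne le_sup_left fun h ↦ ?_)
  have : k ∈ (powMonoidHom 2 : G →* G).range :=
    h ▸ (le_sup_right : f.ker ≤ (powMonoidHom 2 : G →* G).range ⊔ f.ker) hk
  obtain ⟨c, hc⟩ := this
  exact hsq c hc

/-- If a prime `p ≡ 3 mod 4` divides the squarefree `d`, then `d` is not a quotient
`(1 + y ^ 2) / z ^ 2` with rational `y` and `z`. -/
theorem one_add_sq_ne_mul_sq {d p : ℕ} (hd : Squarefree d) (hp : p.Prime) (hp4 : p % 4 = 3)
    (hpd : p ∣ d) (y z : ℚ) : 1 + y ^ 2 ≠ d * z ^ 2 := by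
  intro h
  have : Fact p.Prime := ⟨hp⟩
  have hz : z ≠ 0 := by
    rintro rfl
    nlinarith [sq_nonneg y]
  set w := z.num.natAbs * y.den with hw
  have hw0 : w ≠ 0 := by simp [hw, hz]
  have hsum : d * w ^ 2 = (z.den * y.den) ^ 2 + (z.den * y.num.natAbs) ^ 2 := by
    have hy : (y.num : ℚ) = y * y.den := (Rat.mul_den_eq_num y).symm
    have hz : (z.num : ℚ) = z * z.den := (Rat.mul_den_eq_num z).symm
    zify
    simp only [hw, Nat.cast_mul, Int.natCast_natAbs, mul_pow, sq_abs]
    rify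
    have hy' : (y.num : ℝ) = y * y.den := mod_cast hy
    have hz' : (z.num : ℝ) = z * z.den := mod_cast hz
    have h' : 1 + (y : ℝ) ^ 2 = d * (z : ℝ) ^ 2 := mod_cast h
    rw [hy', hz']
    linear_combination -((z.den : ℝ) ^ 2 * (y.den : ℝ) ^ 2) * h'
  have hd0 := hd.ne_zero
  have hev := Nat.eq_sq_add_sq_iff.1 ⟨_, _, hsum⟩ p
    (Nat.mem_primeFactors.2 ⟨hp, hpd.mul_right _, mul_ne_zero hd0 (pow_ne_zero 2 hw0)⟩) hp4
  have hval : padicValNat p d = 1 := by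
    rw [← Nat.factorization_def d hp]
    exact le_antisymm (hd.natFactorization_le_one p) ((hp.dvd_iff_one_le_factorization hd0).1 hpd)
  rw [padicValNat.mul hd0 (pow_ne_zero 2 hw0), padicValNat.pow, hval] at hev
  exact absurd hev (by rw [Nat.even_iff]; omega)

section QuadraticBasis

variable {K : Type*} [Field K] [CharZero K] {d : ℚ} {s : K}

/-- In a quadratic field, `1` and any irrational element form a basis. -/
theorem exists_basis_one (hfin : Module.finrank ℚ K = 2) (hs : ∀ q : ℚ, (q : K) ≠ s) :
    ∃ b : Module.Basis (Fin 2) ℚ K, ⇑b = ![1, s] := by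
  have hli : LinearIndependent ℚ ![1, s] := by
    rw [LinearIndependent.pair_iff]
    intro x y h
    rw [Algebra.smul_def, Algebra.smul_def, mul_one, eq_ratCast, eq_ratCast] at h
    have hy : y = 0 := by
      by_contra hy
      refine hs (-x / y) ?_
      have : (y : K) ≠ 0 := by exact_mod_cast hy
      push_cast
      field_simp
      linear_combination -h
    subst hy
    simpa using h
  exact ⟨basisOfLinearIndependentOfCardEqFinrank hli (by simp [hfin]), by simp⟩

theorem exists_eq_add_mul (b : Module.Basis (Fin 2) ℚ K) (hb : ⇑b = ![1, s]) (x : K) :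
    ∃ u v : ℚ, x = u + v * s := by
  refine ⟨b.repr x 0, b.repr x 1, ?_⟩
  conv_lhs => rw [← b.sum_repr x]
  simp [hb, Algebra.smul_def]

theorem leftMulMatrix_add_mul (b : Module.Basis (Fin 2) ℚ K) (hb : ⇑b = ![1, s])
    (hsd : s ^ 2 = d) (u v : ℚ) :
    Algebra.leftMulMatrix b (u + v * s) = !![u, d * v; v, u] := by
  have h0 : b 0 = 1 := by simp [hb]
  have h1 : b 1 = s := by simp [hb]
  have e0 : ((u : K) + v * s) * b 0 = u • b 0 + v • b 1 := by
    simp [h0, h1, Algebra.smul_def]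
  have e1 : ((u : K) + v * s) * b 1 = (d * v) • b 0 + u • b 1 := by
    simp only [h0, h1, Algebra.smul_def, eq_ratCast, Rat.cast_mul, ← hsd]
    ring
  ext i j
  rw [Algebra.leftMulMatrix_eq_repr_mul]
  fin_cases j
  · simp only [Fin.zero_eta, e0]
    fin_cases i <;> simp
  · simp only [Fin.mk_one, e1]
    fin_cases i <;> simp

theorem norm_add_mul (b : Module.Basis (Fin 2) ℚ K) (hb : ⇑b = ![1, s])
    (hsd : s ^ 2 = d) (u v : ℚ) : Algebra.norm ℚ ((u : K) + v * s) = u ^ 2 - d * v ^ 2 := by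
  rw [Algebra.norm_eq_matrix_det b, leftMulMatrix_add_mul b hb hsd, Matrix.det_fin_two_of]
  ring

theorem trace_add_mul (b : Module.Basis (Fin 2) ℚ K) (hb : ⇑b = ![1, s])
    (hsd : s ^ 2 = d) (u v : ℚ) : Algebra.trace ℚ K ((u : K) + v * s) = 2 * u := by
  rw [Algebra.trace_eq_matrix_trace b, leftMulMatrix_add_mul b hb hsd, Matrix.trace_fin_two_of]
  ring

theorem discr_one_sqrt (b : Module.Basis (Fin 2) ℚ K) (hb : ⇑b = ![1, s])
    (hsd : s ^ 2 = d) : Algebra.discr ℚ ![1, s] = 4 * d := by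
  have h1 := trace_add_mul b hb hsd 1 0
  have h2 := trace_add_mul b hb hsd 0 1
  have h3 := trace_add_mul b hb hsd d 0
  simp only [Rat.cast_one, Rat.cast_zero, zero_mul, one_mul, add_zero, zero_add, ← hsd] at h1 h2 h3
  rw [Algebra.discr_def, Matrix.det_fin_two]
  simp only [Algebra.traceMatrix_apply, Algebra.traceForm_apply, Matrix.cons_val_zero,
    Matrix.cons_val_one, mul_one, one_mul, h1, h2, ← sq s, h3]
  ring

end QuadraticBasis

/-- The subgroup of totally positive elements of `Kˣ`. -/
noncomputable def totallyPositive (K : Type*) [Field K] : Subgroup Kˣ :=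
  ⨅ σ : K →+* ℝ, (Units.posSubgroup ℝ).comap (Units.map (σ : K →* ℝ))

theorem mem_totallyPositive {K : Type*} [Field K] {x : Kˣ} :
    x ∈ totallyPositive K ↔ ∀ σ : K →+* ℝ, 0 < σ (x : K) := by
  simp [totallyPositive, Subgroup.mem_iInf]

instance totallyPositive_finiteIndex (K : Type*) [Field K] [NumberField K] :
    (totallyPositive K).FiniteIndex := by
  have : Finite (K →+* ℝ) := Finite.of_equiv _ (RingHom.equivRatAlgHom K ℝ).symm
  have hpos : (Units.posSubgroup ℝ).FiniteIndex := by
    refine ⟨?_⟩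
    rw [Subgroup.index_eq_two_iff.2 ⟨-1, fun b ↦ ?_⟩]
    · norm_num
    · rcases lt_or_gt_of_ne b.ne_zero with h | h
      · exact Or.inl ⟨by simpa using h, by simpa using h.le⟩
      · exact Or.inr ⟨by simpa using h, by simpa using h.le⟩
  exact Subgroup.finiteIndex_iInf fun σ ↦ ⟨by
    rw [Subgroup.index_comap]
    exact (Subgroup.instFiniteIndex_subgroupOf _ _).index_ne_zero⟩

section NarrowClassGroup

variable (K : Type*) [Field K] [NumberField K]

theorem closure_totallyPositive_principal :
    Subgroup.closure {I : (FractionalIdeal (𝓞 K)⁰ K)ˣ |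
      ∃ x : Kˣ, (∀ σ : K →+* ℝ, 0 < σ (x : K)) ∧ toPrincipalIdeal (𝓞 K) K x = I} =
    (totallyPositive K).map (toPrincipalIdeal (𝓞 K) K) := by
  rw [← Subgroup.closure_eq ((totallyPositive K).map _)]
  congr 1
  ext I
  simp [mem_totallyPositive]

instance narrowClassGroup_finite : Finite (narrowClassGroup K) := by
  have : Finite ((FractionalIdeal (𝓞 K)⁰ K)ˣ ⧸ (toPrincipalIdeal (𝓞 K) K).range) :=
    Finite.of_equiv _ (ClassGroup.equiv (R := 𝓞 K) K).toEquiv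
  have h : (toPrincipalIdeal (𝓞 K) K).range.FiniteIndex := Subgroup.finiteIndex_of_finite_quotient
  refine @Subgroup.finite_quotient_of_finiteIndex _ _ _ ⟨?_⟩
  rw [closure_totallyPositive_principal, Subgroup.index_map]
  have : (totallyPositive K ⊔ (toPrincipalIdeal (𝓞 K) K).ker).FiniteIndex :=
    Subgroup.finiteIndex_of_le le_sup_left
  exact mul_ne_zero this.index_ne_zero h.index_ne_zero

/-- The canonical surjection from the narrow class group to the class group. -/
noncomputable def narrowToClassGroup : narrowClassGroup K →* ClassGroup (𝓞 K) :=
  (ClassGroup.equiv (R := 𝓞 K) K).symm.toMonoidHom.comp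
    (QuotientGroup.map _ (toPrincipalIdeal (𝓞 K) K).range (MonoidHom.id _) (by
      rw [closure_totallyPositive_principal, Subgroup.comap_id]
      exact Subgroup.map_le_range _ _))

theorem narrowToClassGroup_surjective : Function.Surjective (narrowToClassGroup K) :=
  (ClassGroup.equiv (R := 𝓞 K) K).symm.surjective.comp
    (QuotientGroup.map_surjective_of_surjective _ _ _
      (by exact QuotientGroup.mk_surjective) _)

variable {K}

theorem narrowToClassGroup_principal (x : Kˣ) :
    narrowToClassGroup K (toPrincipalIdeal (𝓞 K) K x : (FractionalIdeal (𝓞 K)⁰ K)ˣ) = 1 := by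
  simp [narrowToClassGroup]

/-- If the narrow class of a principal ideal is a square, then the absolute norm of its generator
is a square times the norm of a totally positive element. -/
theorem exists_norm_eq_of_sq_eq_principal (x : Kˣ) (c : narrowClassGroup K)
    (hc : c ^ 2 = (toPrincipalIdeal (𝓞 K) K x : (FractionalIdeal (𝓞 K)⁰ K)ˣ)) :
    ∃ (α : Kˣ) (n : ℚ), (∀ σ : K →+* ℝ, 0 < σ (α : K)) ∧
      n ^ 2 * |Algebra.norm ℚ (α : K)| = |Algebra.norm ℚ (x : K)| := by
  obtain ⟨I, rfl⟩ := QuotientGroup.mk_surjective c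
  rw [← QuotientGroup.mk_pow, QuotientGroup.eq, closure_totallyPositive_principal] at hc
  obtain ⟨α, hα, hαI⟩ := hc
  refine ⟨α, FractionalIdeal.absNorm (I : FractionalIdeal (𝓞 K)⁰ K), mem_totallyPositive.1 hα, ?_⟩
  rw [eq_inv_mul_iff_mul_eq] at hαI
  have := congrArg (fun J : (FractionalIdeal (𝓞 K)⁰ K)ˣ ↦
    FractionalIdeal.absNorm (J : FractionalIdeal (𝓞 K)⁰ K)) hαI
  simpa [FractionalIdeal.absNorm_span_singleton] using this

/-- In the real quadratic field `ℚ(√d)` with `d` squarefree and divisible by a prime `p ≡ 3 mod 4`,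
the narrow class of `√d` is not a square. -/
theorem sq_ne_principal_sqrt {d p : ℕ} (hd : Squarefree d) (hp : p.Prime)
    (hp4 : p % 4 = 3) (hpd : p ∣ d) {s : Kˣ} (hsd : (s : K) ^ 2 = d)
    (b : Module.Basis (Fin 2) ℚ K) (hb : ⇑b = ![1, (s : K)]) (hreal : Nat.card (K →+* ℝ) = 2)
    (c : narrowClassGroup K) :
    c ^ 2 ≠ (toPrincipalIdeal (𝓞 K) K s : (FractionalIdeal (𝓞 K)⁰ K)ˣ) := by
  intro hc
  have hd0 : (d : ℚ) ≠ 0 := mod_cast hd.ne_zero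
  have hsd' : (s : K) ^ 2 = ((d : ℚ) : K) := by simpa using hsd
  obtain ⟨α, n, hα, hn⟩ := exists_norm_eq_of_sq_eq_principal _ c hc
  obtain ⟨u, v, huv⟩ := exists_eq_add_mul b hb (α : K)
  have hnorm_s := norm_add_mul b hb hsd' 0 1
  simp only [Rat.cast_zero, Rat.cast_one, one_mul, zero_add] at hnorm_s
  rw [huv, norm_add_mul b hb hsd', hnorm_s] at hn
  obtain ⟨σ, τ, hστ⟩ : ∃ σ τ : K →+* ℝ, σ ≠ τ := by
    have : Finite (K →+* ℝ) := Nat.finite_of_card_ne_zero (by omega)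
    have : Nontrivial (K →+* ℝ) := Finite.one_lt_card_iff_nontrivial.1 (by omega)
    exact exists_pair_ne _
  have hsq (ρ : K →+* ℝ) : ρ s ^ 2 = d := by simpa using congrArg ρ hsd
  have hneg : τ s = -σ s := by
    refine (sq_eq_sq_iff_eq_or_eq_neg.1 ((hsq τ).trans (hsq σ).symm)).resolve_left fun h ↦ hστ ?_
    ext x
    obtain ⟨u, v, rfl⟩ := exists_eq_add_mul b hb x
    simp [h]
  have hpos : 0 < u ^ 2 - d * v ^ 2 := by
    have h1 := mul_pos (hα σ) (hα τ)
    rw [huv] at h1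
    simp only [map_add, map_mul, map_ratCast, hneg] at h1
    have h2 : 0 < (u : ℝ) ^ 2 - d * (v : ℝ) ^ 2 := by
      rw [← hsq σ]
      linear_combination h1
    exact_mod_cast h2
  have hdpos : (0 : ℚ) < d := lt_of_le_of_ne (by positivity) hd0.symm
  rw [abs_of_pos hpos, show (0 : ℚ) ^ 2 - d * 1 ^ 2 = -d by ring, abs_neg, abs_of_pos hdpos] at hn
  refine one_add_sq_ne_mul_sq hd hp hp4 hpd (n * v) (n * u / d) ?_
  field_simp
  linear_combination -hn

/-- In the real quadratic field `ℚ(√d)` with `d` squarefree and divisible by a prime `p ≡ 3 mod 4`,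
the narrow class group has more 2-torsion than the class group. -/
theorem card_two_torsion_classGroup_lt {d p : ℕ} (hd : Squarefree d) (hp : p.Prime)
    (hp4 : p % 4 = 3) (hpd : p ∣ d) {s : K} (hsd : s ^ 2 = d)
    (b : Module.Basis (Fin 2) ℚ K) (hb : ⇑b = ![1, s]) (hreal : Nat.card (K →+* ℝ) = 2) :
    Nat.card {c : ClassGroup (𝓞 K) // c ^ 2 = 1} <
      Nat.card {c : narrowClassGroup K // c ^ 2 = 1} := by
  have hs0 : s ≠ 0 := by
    rintro rfl
    have : (d : K) ≠ 0 := mod_cast hd.ne_zero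
    simp [eq_comm, this] at hsd
  refine card_two_torsion_lt_of_surjective (fun x y ↦ ?_) (narrowToClassGroup K)
    (narrowToClassGroup_surjective K) _ (narrowToClassGroup_principal (Units.mk0 s hs0))
    (sq_ne_principal_sqrt hd hp hp4 hpd (s := Units.mk0 s hs0) hsd b hb hreal)
  obtain ⟨a, rfl⟩ := QuotientGroup.mk_surjective x
  obtain ⟨b, rfl⟩ := QuotientGroup.mk_surjective y
  rw [← QuotientGroup.mk_mul, ← QuotientGroup.mk_mul, mul_comm]

end NarrowClassGroup

/-- Squarefree numbers that differ by the square of a rational are equal. -/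
theorem eq_of_squarefree_of_eq_sq_mul {d e : ℕ} (hd : Squarefree d) (he : Squarefree e) {v : ℚ}
    (h : (d : ℚ) = v ^ 2 * e) : d = e := by
  have hd0 := hd.ne_zero
  have hv : v ≠ 0 := by
    rintro rfl
    simp [hd0] at h
  have hv0 : v.num.natAbs ≠ 0 := by simpa using hv
  have hnat : v.den ^ 2 * d = v.num.natAbs ^ 2 * e := by
    have hv' : (v.num : ℚ) = v * v.den := (Rat.mul_den_eq_num v).symm
    zify
    rw [sq_abs]
    have : (v.den : ℚ) ^ 2 * d = (v.num : ℚ) ^ 2 * e := by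
      rw [hv', h]
      ring
    exact_mod_cast this
  refine Nat.eq_of_factorization_eq hd0 he.ne_zero fun p ↦ ?_
  have hp := congrArg (fun n ↦ n.factorization p) hnat
  simp only [Nat.factorization_mul (pow_ne_zero 2 v.den_nz) hd0,
    Nat.factorization_mul (pow_ne_zero 2 hv0) he.ne_zero, Nat.factorization_pow,
    Finsupp.add_apply, Finsupp.smul_apply, smul_eq_mul] at hp
  have := hd.natFactorization_le_one p
  have := he.natFactorization_le_one p
  omega

/-- A square root of a squarefree number other than `1` is irrational. -/
theorem ratCast_ne_of_sq_eq {K : Type*} [Field K] [CharZero K] {d : ℕ} {s : K}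
    (hd : Squarefree d) (hd1 : d ≠ 1) (hs : s ^ 2 = d) (q : ℚ) : (q : K) ≠ s := by
  rintro rfl
  refine hd1 (eq_of_squarefree_of_eq_sq_mul hd squarefree_one (v := q) ?_)
  rw [Nat.cast_one, mul_one]
  exact_mod_cast hs.symm

/-- Every real quadratic field is `ℚ(√d)` with `d > 1` squarefree. -/
theorem exists_squarefree_sq_eq {K : Type*} [Field K] [CharZero K]
    (hfin : Module.finrank ℚ K = 2) (σ : K →+* ℝ) :
    ∃ d : ℕ, Squarefree d ∧ d ≠ 1 ∧ ∃ s : K, s ^ 2 = d := by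
  obtain ⟨x, hx⟩ : ∃ x : K, ∀ q : ℚ, (q : K) ≠ x := by
    by_contra! h
    have : (⊥ : Subalgebra ℚ K) = ⊤ := by
      refine top_unique fun x _ ↦ ?_
      obtain ⟨q, rfl⟩ := h x
      exact Algebra.mem_bot.2 ⟨q, by simp⟩
    rw [Subalgebra.bot_eq_top_iff_finrank_eq_one] at this
    omega
  obtain ⟨b, hb⟩ := exists_basis_one hfin hx
  obtain ⟨u, v, huv⟩ := exists_eq_add_mul b hb (x ^ 2)
  set r : ℚ := 4 * u + v ^ 2 with hr
  have hy : (2 * x - v) ^ 2 = (r : K) := by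
    simp only [hr]
    push_cast
    linear_combination 4 * huv
  have hy0 (q : ℚ) : (q : K) ≠ 2 * x - v := fun h ↦ hx ((q + v) / 2) (by
    push_cast
    rw [h]
    ring)
  have hrpos : 0 < r := by
    have h1 : σ (2 * x - v) ^ 2 = r := by rw [← map_pow, hy, map_ratCast]
    have h2 : σ (2 * x - v) ≠ 0 := by
      rw [map_ne_zero]
      exact fun h ↦ hy0 0 (by simp [h])
    have h3 : (0 : ℝ) < r := h1 ▸ by positivity
    exact_mod_cast h3
  obtain ⟨d, m, hdm, hd⟩ := Nat.sq_mul_squarefree (r.num.natAbs * r.den)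
  have hm : m ≠ 0 := by
    rintro rfl
    have h1 := Rat.num_pos.2 hrpos
    have h2 := r.den_nz
    rw [zero_pow two_ne_zero, zero_mul, eq_comm, mul_eq_zero, Int.natAbs_eq_zero] at hdm
    omega
  have hmK : (m : K) ≠ 0 := mod_cast hm
  have hdmQ : (m : ℚ) ^ 2 * d = r * r.den ^ 2 := by
    have h1 : (m : ℚ) ^ 2 * d = r.num.natAbs * r.den := mod_cast hdm
    rw [h1, Nat.cast_natAbs, abs_of_pos (Rat.num_pos.2 hrpos), sq, ← mul_assoc,
      Rat.mul_den_eq_num r]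
  have hs : (r.den * (2 * x - v) / m) ^ 2 = (d : K) := by
    rw [div_pow, mul_pow, hy, div_eq_iff (pow_ne_zero 2 hmK)]
    have : (m : K) ^ 2 * d = r * r.den ^ 2 := mod_cast congrArg (Rat.cast (K := K)) hdmQ
    linear_combination -this
  refine ⟨d, hd, ?_, _, hs⟩
  rintro rfl
  have hden : (r.den : K) ≠ 0 := mod_cast r.den_nz
  rcases eq_or_eq_neg_of_sq_eq_sq _ 1 (hs.trans (by simp)) with h | h
  · refine hy0 (m / r.den) ?_
    rw [div_eq_iff hmK] at h
    push_cast
    rw [div_eq_iff hden]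
    linear_combination -h
  · refine hy0 (-m / r.den) ?_
    rw [div_eq_iff hmK] at h
    push_cast
    rw [div_eq_iff hden]
    linear_combination -h

/-- The discriminant of `ℚ(√d)` divides `4 * d`, with quotient a square. -/
theorem exists_four_mul_eq_sq_mul_discr {K : Type*} [Field K] [NumberField K]
    (hfin : Module.finrank ℚ K = 2) {d : ℕ} (hd : Squarefree d) (hd1 : d ≠ 1) {s : K}
    (hs : s ^ 2 = d) : ∃ n : ℤ, 4 * d = n ^ 2 * NumberField.discr K := by
  obtain ⟨b, hb⟩ := exists_basis_one hfin (ratCast_ne_of_sq_eq hd hd1 hs)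
  have hcard : Fintype.card (Module.Free.ChooseBasisIndex ℤ (𝓞 K)) = Fintype.card (Fin 2) := by
    rw [← Module.finrank_eq_card_chooseBasisIndex, RingOfIntegers.rank, hfin, Fintype.card_fin]
  let e := Fintype.equivOfCardEq hcard
  let B := (integralBasis K).reindex e
  have hB : Algebra.discr ℚ B = NumberField.discr K := by
    rw [coe_discr, ← Algebra.discr_reindex ℚ (integralBasis K) e, Module.Basis.coe_reindex]
  have hint : IsIntegral ℤ s := ⟨Polynomial.X ^ 2 - Polynomial.C (d : ℤ),
    Polynomial.monic_X_pow_sub_C _ two_ne_zero, by simp [hs]⟩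
  have hentry (i j : Fin 2) : IsIntegral ℤ (B.toMatrix ![1, s] i j) := by
    have key (x : K) (hx : IsIntegral ℤ x) (i : Fin 2) : IsIntegral ℤ (B.repr x i) := by
      have := integralBasis_repr_apply K ⟨x, hx⟩ (e.symm i)
      rw [Module.Basis.repr_reindex_apply]
      erw [this]
      exact isIntegral_algebraMap
    rw [Module.Basis.toMatrix_apply]
    fin_cases j
    · exact key 1 isIntegral_one i
    · exact key s hint i
  obtain ⟨n, hn⟩ := IsIntegrallyClosed.isIntegral_iff.1 (IsIntegral.det hentry)
  refine ⟨n, ?_⟩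
  have hP : Matrix.vecMul B ((B.toMatrix ![1, s]).map (algebraMap ℚ K)) = ![1, s] := by
    ext j
    rw [← B.sum_toMatrix_smul_self ![1, s] j]
    simp [Matrix.vecMul, dotProduct, Algebra.smul_def, mul_comm]
  have h1 := Algebra.discr_of_matrix_vecMul (A := ℚ) B (B.toMatrix ![1, s])
  rw [hP, discr_one_sqrt (d := d) b hb (by simpa using hs), hB, ← hn] at h1
  simp only [eq_intCast] at h1
  exact_mod_cast h1

/-- The discriminant of `ℚ(√d)` lies between `d` and `4 * d`. -/
theorem le_discr_and_discr_le {K : Type*} [Field K] [NumberField K]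
    (hfin : Module.finrank ℚ K = 2) {d : ℕ} (hd : Squarefree d) (hd1 : d ≠ 1) {s : K}
    (hs : s ^ 2 = d) : d ≤ NumberField.discr K ∧ NumberField.discr K ≤ 4 * d := by
  obtain ⟨n, hn⟩ := exists_four_mul_eq_sq_mul_discr hfin hd hd1 hs
  have hd0 : (0 : ℤ) < d := by
    have := hd.ne_zero
    omega
  have hn0 : n ≠ 0 := by
    rintro rfl
    simp [hd.ne_zero] at hn
  have hn1 : 0 < n ^ 2 := by positivity
  have hdisc : 0 < NumberField.discr K := by nlinarith
  refine ⟨?_, by nlinarith⟩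
  have hdZ : Squarefree (d : ℤ) := Int.squarefree_natCast.2 hd
  have hn4 : n ^ 2 ≤ 4 := by
    rcases Int.even_or_odd' n with ⟨m, rfl | rfl⟩
    · have hm : IsUnit m := hdZ m ⟨NumberField.discr K, by linarith⟩
      rcases Int.isUnit_iff.1 hm with rfl | rfl <;> norm_num
    · have hco : IsCoprime ((2 * m + 1) * (2 * m + 1)) 4 := by
        have : IsCoprime (2 * m + 1) 2 := ⟨1, -m, by ring⟩
        have := this.mul_right this
        norm_num at this
        exact this.mul_left this
      have hm : IsUnit (2 * m + 1) :=
        hdZ _ (hco.dvd_of_dvd_mul_left ⟨NumberField.discr K, by linarith⟩)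
      rcases Int.isUnit_iff.1 hm with h | h <;> rw [h] <;> norm_num
  nlinarith

/-- A quadratic field containing a square root of a positive number has two real embeddings. -/
theorem card_ringHom_real_eq_two {K : Type*} [Field K] [CharZero K]
    (hfin : Module.finrank ℚ K = 2) {d : ℕ} (hd : Squarefree d) (hd1 : d ≠ 1) {s : K}
    (hs : s ^ 2 = d) : Nat.card (K →+* ℝ) = 2 := by
  have : FiniteDimensional ℚ K := Module.finite_of_finrank_eq_succ hfin
  obtain ⟨b, hb⟩ := exists_basis_one hfin (ratCast_ne_of_sq_eq hd hd1 hs)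
  rw [Nat.card_congr (RingHom.equivRatAlgHom K ℝ), AlgHom.natCard_of_splits ℚ K ℝ, hfin]
  intro x
  obtain ⟨u, v, rfl⟩ := exists_eq_add_mul b hb x
  have hdvd : minpoly ℚ ((u : K) + v * s) ∣
      (Polynomial.X - Polynomial.C u) ^ 2 - Polynomial.C (v ^ 2 * d) := by
    refine minpoly.dvd _ _ ?_
    simp [mul_pow, hs]
  have hfactor : ((Polynomial.X - Polynomial.C u) ^ 2 - Polynomial.C (v ^ 2 * d) :
      Polynomial ℚ).map (algebraMap ℚ ℝ) = (Polynomial.X - Polynomial.C ((u : ℝ) + v * √d)) *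
        (Polynomial.X - Polynomial.C ((u : ℝ) - v * √d)) := by
    have h : algebraMap ℚ ℝ (v ^ 2 * d) = (v * √d) ^ 2 := by
      simp [mul_pow, Real.sq_sqrt (Nat.cast_nonneg d)]
    rw [Polynomial.map_sub, Polynomial.map_pow, Polynomial.map_sub, Polynomial.map_X,
      Polynomial.map_C, Polynomial.map_C, h, Polynomial.C_add, Polynomial.C_sub, Polynomial.C_pow,
      eq_ratCast]
    ring
  refine Polynomial.Splits.of_dvd ?_ ?_ (Polynomial.map_dvd (algebraMap ℚ ℝ) hdvd)
  · rw [hfactor]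
    exact (Polynomial.Splits.X_sub_C _).mul (Polynomial.Splits.X_sub_C _)
  · rw [hfactor]
    exact mul_ne_zero (Polynomial.X_sub_C_ne_zero _) (Polynomial.X_sub_C_ne_zero _)

section Counting

variable {K L : IntermediateField ℚ ℂ} {d : ℕ}

theorem intDisc_eq_discr (K : IntermediateField ℚ ℂ) [NumberField K] :
    intDisc K = NumberField.discr K :=
  dif_pos NumberField.to_finiteDimensional

theorem cl2PlusCard_eq (K : IntermediateField ℚ ℂ) [NumberField K] :
    cl2PlusCard K = Nat.card {c : narrowClassGroup K // c ^ 2 = 1} :=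
  dif_pos NumberField.to_finiteDimensional

theorem numberField_of_finrank_eq_two (hK : Module.finrank ℚ K = 2) : NumberField K :=
  @NumberField.mk _ _ _ (Module.finite_of_finrank_eq_succ hK)

theorem IsRealQuadratic.exists_squarefree_sq_eq (hK : IsRealQuadratic K) :
    ∃ d : ℕ, Squarefree d ∧ d ≠ 1 ∧ ∃ s : K, s ^ 2 = d := by
  have : Nonempty (K →+* ℝ) := (Nat.card_ne_zero.1 (by rw [hK.2]; exact two_ne_zero)).1
  exact _root_.exists_squarefree_sq_eq hK.1 this.some

/-- The discriminant of `ℚ(√d)` inside `ℂ` lies between `d` and `4 * d`. -/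
theorem le_intDisc_and_intDisc_le (hK : Module.finrank ℚ K = 2) (hd : Squarefree d) (hd1 : d ≠ 1)
    {s : K} (hs : s ^ 2 = d) : d ≤ intDisc K ∧ intDisc K ≤ 4 * d := by
  have := numberField_of_finrank_eq_two hK
  rw [intDisc_eq_discr]
  exact le_discr_and_discr_le hK hd hd1 hs

/-- A prime factor `p ≡ 3 mod 4` of `d` makes the narrow 2-torsion of `ℚ(√d)` larger. -/
theorem cl2Card_lt_cl2PlusCard (hK : IsRealQuadratic K) (hd : Squarefree d) (hd1 : d ≠ 1)
    {s : K} (hs : s ^ 2 = d) {p : ℕ} (hp : p.Prime) (hp4 : p % 4 = 3) (hpd : p ∣ d) :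
    cl2Card K < cl2PlusCard K := by
  have := numberField_of_finrank_eq_two hK.1
  obtain ⟨b, hb⟩ := exists_basis_one hK.1 (ratCast_ne_of_sq_eq hd hd1 hs)
  rw [cl2PlusCard_eq]
  exact card_two_torsion_classGroup_lt hd hp hp4 hpd hs b hb hK.2

/-- Quadratic subfields of `ℂ` are determined by the number under the root. -/
theorem le_of_sq_eq (hK : Module.finrank ℚ K = 2) (hd : Squarefree d) (hd1 : d ≠ 1)
    {s : K} {t : L} (hs : s ^ 2 = d) (ht : t ^ 2 = d) : K ≤ L := by
  obtain ⟨b, hb⟩ := exists_basis_one hK (ratCast_ne_of_sq_eq hd hd1 hs)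
  have hst : (s : ℂ) ^ 2 = (t : ℂ) ^ 2 :=
    (congrArg (fun x : K ↦ (x : ℂ)) hs).trans (congrArg (fun x : L ↦ (x : ℂ)) ht).symm
  have hsL : (s : ℂ) ∈ L := by
    rcases sq_eq_sq_iff_eq_or_eq_neg.1 hst with h | h <;> rw [h]
    · exact t.2
    · exact neg_mem t.2
  intro x hx
  obtain ⟨u, v, huv⟩ := exists_eq_add_mul b hb ⟨x, hx⟩
  have hx' : x = (u : ℂ) + v * s := congrArg (fun x : K ↦ (x : ℂ)) huv
  rw [hx']
  exact add_mem (SubfieldClass.ratCast_mem L u) (mul_mem (SubfieldClass.ratCast_mem L v) hsL)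

/-- A quadratic field contains the square root of only one squarefree `d ≠ 1`. -/
theorem radicand_unique {F : Type*} [Field F] [CharZero F] (hF : Module.finrank ℚ F = 2)
    {d e : ℕ} (hd : Squarefree d) (hd1 : d ≠ 1) (he : Squarefree e) (he1 : e ≠ 1) {s t : F}
    (hs : s ^ 2 = d) (ht : t ^ 2 = e) : d = e := by
  have hirr := ratCast_ne_of_sq_eq hd hd1 hs
  obtain ⟨b, hb⟩ := exists_basis_one hF hirr
  obtain ⟨u, v, huv⟩ := exists_eq_add_mul b hb t
  have h1 : (e : F) = u ^ 2 + v ^ 2 * d + 2 * u * v * s := by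
    rw [← ht, huv, ← hs]
    ring
  have huv0 : u * v = 0 := by
    by_contra h
    have h' : (u : F) * v ≠ 0 := mod_cast h
    refine hirr ((e - u ^ 2 - v ^ 2 * d) / (2 * (u * v))) ?_
    push_cast
    rw [div_eq_iff (mul_ne_zero two_ne_zero h'), h1]
    ring
  rcases mul_eq_zero.1 huv0 with rfl | rfl
  · refine (eq_of_squarefree_of_eq_sq_mul he hd (v := v) ?_).symm
    have : (e : F) = v ^ 2 * d := by simpa using h1
    exact_mod_cast this
  · exact absurd (by simpa using huv.symm) (ratCast_ne_of_sq_eq he he1 ht u)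

/-- Every squarefree `d ≠ 1` has a square root in a quadratic subfield of `ℂ`. -/
theorem exists_intermediateField_sq_eq (hd : Squarefree d) (hd1 : d ≠ 1) :
    ∃ K : IntermediateField ℚ ℂ, Module.finrank ℚ K = 2 ∧ ∃ s : K, s ^ 2 = d := by
  obtain ⟨z, hz⟩ := IsAlgClosed.exists_pow_nat_eq (d : ℂ) two_pos
  refine ⟨IntermediateField.adjoin ℚ {z}, ?_, ⟨z, IntermediateField.mem_adjoin_simple_self ℚ z⟩,
    Subtype.ext (by simpa using hz)⟩
  have hroot : Polynomial.aeval z (Polynomial.X ^ 2 - Polynomial.C (d : ℚ)) = 0 := by simp [hz]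
  have hmonic : (Polynomial.X ^ 2 - Polynomial.C (d : ℚ)).Monic :=
    Polynomial.monic_X_pow_sub_C _ two_ne_zero
  have hirr : Irreducible (Polynomial.X ^ 2 - Polynomial.C (d : ℚ)) := by
    refine X_pow_sub_C_irreducible_of_prime Nat.prime_two fun q hq ↦ ?_
    exact ratCast_ne_of_sq_eq (s := q) hd hd1 hq q (by simp)
  rw [IntermediateField.adjoin.finrank ⟨_, hmonic, by simpa using hroot⟩,
    ← minpoly.eq_of_irreducible_of_monic hirr hroot hmonic, Polynomial.natDegree_X_pow_sub_C]

/-- A class of real quadratic fields is determined by the squarefree number under the root. -/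
theorem finite_and_classCount_le {P : IntermediateField ℚ ℂ → Prop} {S : Finset ℕ}
    (hP : ∀ K, P K → IsRealQuadratic K)
    (hS : ∀ (K : IntermediateField ℚ ℂ) (d : ℕ) (s : K), P K → Squarefree d → d ≠ 1 →
      s ^ 2 = d → d ∈ S) :
    Finite {c : FieldClass // P c.out} ∧ classCount P ≤ S.card := by
  choose f hf hf1 s hs using fun c : {c : FieldClass // P c.out} ↦
    (hP _ c.2).exists_squarefree_sq_eq
  let g : {c : FieldClass // P c.out} → S :=
    fun c ↦ ⟨f c, hS _ _ (s c) c.2 (hf c) (hf1 c) (hs c)⟩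
  have hg : Function.Injective g := by
    intro c c' h
    have h : f c = f c' := congrArg Subtype.val h
    have hs' : s c' ^ 2 = (f c : ℕ) := by rw [hs, h]
    refine Subtype.ext (Quotient.out_injective (le_antisymm ?_ ?_))
    · exact le_of_sq_eq (hP _ c.2).1 (hf c) (hf1 c) (hs c) hs'
    · exact le_of_sq_eq (hP _ c'.2).1 (hf c) (hf1 c) hs' (hs c)
  refine ⟨Finite.of_injective g hg, ?_⟩
  simpa [classCount] using Nat.card_le_card_of_injective g hg

/-- Distinct squarefree numbers give distinct classes of quadratic fields. -/
theorem card_le_classCount {P : IntermediateField ℚ ℂ → Prop} {S : Finset ℕ}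
    [Finite {c : FieldClass // P c.out}] (hS : ∀ d ∈ S, Squarefree d ∧ d ≠ 1)
    (hP : ∀ (K : IntermediateField ℚ ℂ) (d : ℕ) (s : K), d ∈ S → Module.finrank ℚ K = 2 →
      s ^ 2 = d → P K) :
    S.card ≤ classCount P := by
  choose F hF t ht using fun d : S ↦ exists_intermediateField_sq_eq (hS d d.2).1 (hS d d.2).2
  have hiso (d : S) : Nonempty ((⟦F d⟧ : FieldClass).out ≃ₐ[ℚ] F d) :=
    Quotient.mk_out (s := isoSetoid) (F d)
  let g : S → {c : FieldClass // P c.out} := fun d ↦ ⟨⟦F d⟧, by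
    have e := (hiso d).some
    refine hP _ d (e.symm (t d)) d.2 (e.toLinearEquiv.finrank_eq.trans (hF d)) ?_
    rw [← map_pow, ht, map_natCast]⟩
  have hg : Function.Injective g := by
    intro d e h
    obtain ⟨φ⟩ : Nonempty (F d ≃ₐ[ℚ] F e) := Quotient.exact (congrArg Subtype.val h)
    refine Subtype.ext (radicand_unique (hF e) (hS d d.2).1 (hS d d.2).2 (hS e e.2).1
      (hS e e.2).2 (s := φ (t d)) (t := t e) ?_ (ht e))
    rw [← map_pow, ht, map_natCast]
  simpa [classCount] using Nat.card_le_card_of_injective g hg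

end Counting

section Density

/-- Real quadratic fields of discriminant below `X` form finitely many classes. -/
theorem finite_realQuadratic_intDisc_lt (X : ℝ) :
    Finite {c : FieldClass // IsRealQuadratic c.out ∧ (intDisc c.out : ℝ) < X} := by
  refine (finite_and_classCount_le (P := fun K ↦ IsRealQuadratic K ∧ (intDisc K : ℝ) < X)
    (S := Finset.range ⌈X⌉₊) (fun K h ↦ h.1) ?_).1
  intro K d s hK hd hd1 hs
  rw [Finset.mem_range, Nat.lt_ceil]
  have : (d : ℝ) ≤ intDisc K := mod_cast (le_intDisc_and_intDisc_le hK.1.1 hd hd1 hs).1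
  exact this.trans_lt hK.2

theorem classCount_cl2PlusCard_eq_le (X : ℝ) :
    classCount (fun K ↦ IsRealQuadratic K ∧ (intDisc K : ℝ) < X ∧ cl2PlusCard K = cl2Card K) ≤
      ((Finset.range ⌈X⌉₊).filter
        fun n ↦ ∀ p : ℕ, p ∈ n.primeFactors → (p : ZMod 4) ≠ 3).card := by
  refine (finite_and_classCount_le (fun K h ↦ h.1) ?_).2
  intro K d s hK hd hd1 hs
  rw [Finset.mem_filter, Finset.mem_range, Nat.lt_ceil]
  have : (d : ℝ) ≤ intDisc K := mod_cast (le_intDisc_and_intDisc_le hK.1.1 hd hd1 hs).1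
  refine ⟨this.trans_lt hK.2.1, fun p hp hp3 ↦ ?_⟩
  have hp4 : p % 4 = 3 := (ZMod.natCast_eq_natCast_iff' p 3 4).1 (mod_cast hp3)
  exact (cl2Card_lt_cl2PlusCard hK.1 hd hd1 hs (Nat.prime_of_mem_primeFactors hp) hp4
    (Nat.dvd_of_mem_primeFactors hp)).ne' hK.2.2

theorem le_classCount_realQuadratic (X : ℝ) :
    X / 12 - 4 / 3 ≤ classCount (fun K ↦ IsRealQuadratic K ∧ (intDisc K : ℝ) < X) := by
  have := finite_realQuadratic_intDisc_lt X
  set N := ⌈X / 4⌉₊ - 1 with hN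
  have hcard : (((Finset.Ioc 0 N).filter Squarefree).erase 1).card ≤
      classCount (fun K ↦ IsRealQuadratic K ∧ (intDisc K : ℝ) < X) := by
    refine card_le_classCount (fun d hd ↦ ?_) fun K d s hd hK hs ↦ ?_
    · rw [Finset.mem_erase, Finset.mem_filter] at hd
      exact ⟨hd.2.2, hd.1⟩
    · rw [Finset.mem_erase, Finset.mem_filter, Finset.mem_Ioc] at hd
      obtain ⟨hd1, ⟨hd0, hdN⟩, hd⟩ := hd
      refine ⟨⟨hK, card_ringHom_real_eq_two hK hd hd1 hs⟩, ?_⟩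
      have h1 : (intDisc K : ℝ) ≤ 4 * d := mod_cast (le_intDisc_and_intDisc_le hK hd hd1 hs).2
      have h2 : (d : ℝ) < X / 4 := Nat.lt_ceil.1 (by omega)
      linarith
  have h1 := le_three_mul_card_squarefree N
  have h2 := Finset.pred_card_le_card_erase (s := (Finset.Ioc 0 N).filter Squarefree) (a := 1)
  have h3 : ⌈X / 4⌉₊ ≤
      3 * classCount (fun K ↦ IsRealQuadratic K ∧ (intDisc K : ℝ) < X) + 4 := by omega
  have h4 := Nat.le_ceil (X / 4)
  have h5 : (⌈X / 4⌉₊ : ℝ) ≤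
      3 * classCount (fun K ↦ IsRealQuadratic K ∧ (intDisc K : ℝ) < X) + 4 := mod_cast h3
  linarith

end Density

/-- When real quadratic fields are ordered by discriminant, a density of
`100%` of them satisfy `Cl₂(F) ≠ Cl₂⁺(F)`. -/
theorem real_quadratic_narrow_ne_class_group_two_torsion :
    Filter.Tendsto (fun X : ℝ =>
      (classCount (fun K => IsRealQuadratic K ∧ (intDisc K : ℝ) < X ∧ cl2PlusCard K = cl2Card K) : ℝ) /
      (classCount (fun K => IsRealQuadratic K ∧ (intDisc K : ℝ) < X) : ℝ))
      Filter.atTop (nhds 0) := by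
  rw [Metric.tendsto_atTop]
  intro δ hδ
  have h3 : IsUnit (3 : ZMod 4) := by decide
  obtain ⟨C, hC⟩ := card_filter_coprime_residueClass_le h3 (ε := δ / 48) (by positivity)
  refine ⟨max 32 (48 * (δ / 48 + C) / δ + 1), fun X hX ↦ ?_⟩
  have hX32 : 32 ≤ X := (le_max_left _ _).trans hX
  have hXC : 48 * (δ / 48 + C) < δ * X := by
    rw [← div_lt_iff₀' hδ]
    linarith [(le_max_right _ _).trans hX]
  have hden := le_classCount_realQuadratic X
  have hnum := (Nat.cast_le (α := ℝ)).2 (classCount_cl2PlusCard_eq_le X)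
  have hC' := hC ⌈X⌉₊
  have hceil := mul_le_mul_of_nonneg_left (Nat.ceil_lt_add_one (by linarith : 0 ≤ X)).le
    (by positivity : 0 ≤ δ / 48)
  rw [Real.dist_0_eq_abs, abs_of_nonneg (by positivity), div_lt_iff₀ (by linarith)]
  have := mul_le_mul_of_nonneg_left hden hδ.le
  nlinarith
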